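/- For every n ≥ 3, the extension P_{n−2}·S_Δ of the principal (n−2)-minor ideal to the localization S_Δ = S[1/Δ] is a prime ideal of S_Δ of height n(n−1)/2. (Equivalently, the locally closed set Y_{n,n,n−2} of invertible matrices with vanishing principal (n−2)-minors is irreducible of codimension n(n−1)/2.) -/

import Mathlib

open Matrix

/-- The generic `n × n` matrix whose entries are the variables `x i j` of the
polynomial ring `K[X]`. -/
noncomputable def genMat (K : Type*) [Field K] (n : ℕ) :
    Matrix (Fin n) (Fin n) (MvPolynomial (Fin n × Fin n) K) :=
  fun i j => MvPolynomial.X (i, j)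

/-- `P_t`: the ideal generated by the principal `t`-minors of the generic matrix,
i.e. the determinants of the submatrices whose rows and columns are both indexed by
a subset `s` of cardinality `t`. -/
noncomputable def prinMinorIdeal (K : Type*) [Field K] (n t : ℕ) :
    Ideal (MvPolynomial (Fin n × Fin n) K) :=
  Ideal.span {p | ∃ s : Finset (Fin n), s.card = t ∧
    p = ((genMat K n).submatrix (fun i : {x // x ∈ s} => (i : Fin n))
        (fun j : {x // x ∈ s} => (j : Fin n))).det}

/-- The height of an ideal: the infimum of the heights of the prime ideals
containing it (heights taken in the prime spectrum ordered by inclusion). -/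
noncomputable def idealHeight {R : Type*} [CommRing R] (I : Ideal R) : ℕ∞ :=
  ⨅ (p : PrimeSpectrum R) (_ : I ≤ p.asIdeal), Order.height p

/-- A monomial change of grading on a polynomial ring: the monomial with exponent `m` is sent to
the element `W m` of the additive monoid algebra. -/
noncomputable def monomialHom {σ R G : Type*} [CommRing R] [AddCommMonoid G]
    (W : (σ →₀ ℕ) →+ G) : MvPolynomial σ R →+* AddMonoidAlgebra R G :=
  AddMonoidAlgebra.mapDomainRingHom R W

section

variable {σ R G : Type*} [CommRing R] [AddCommMonoid G] (W : (σ →₀ ℕ) →+ G)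

theorem monomialHom_monomial (m : σ →₀ ℕ) (c : R) :
    monomialHom W (MvPolynomial.monomial m c) = AddMonoidAlgebra.single (W m) c :=
  AddMonoidAlgebra.mapDomain_single

theorem eq_zero_of_monomialHom_eq_zero {N : Set (σ →₀ ℕ)} (hN : Set.InjOn W N)
    {g : MvPolynomial σ R} (hg : (g.support : Set (σ →₀ ℕ)) ⊆ N) (h : monomialHom W g = 0) :
    g = 0 := by
  have : AddMonoidAlgebra.coeff (monomialHom W g) =
      Finsupp.mapDomain W (AddMonoidAlgebra.coeff g) := rfl
  rw [h] at this
  apply AddMonoidAlgebra.coeff_injective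
  apply Finsupp.mapDomain_injOn N hN
  · exact hg
  · simp
  · rw [← this]; simp

theorem ker_monomialHom_eq {N : Set (σ →₀ ℕ)} (hN : Set.InjOn W N) {I : Ideal (MvPolynomial σ R)}
    (hI : I ≤ RingHom.ker (monomialHom W))
    (hred : ∀ m, ∃ m' ∈ N, MvPolynomial.monomial m (1 : R) - MvPolynomial.monomial m' 1 ∈ I) :
    RingHom.ker (monomialHom W) = I := by
  refine le_antisymm (fun f hf => ?_) hI
  have key : ∀ f : MvPolynomial σ R, ∃ g : MvPolynomial σ R,
      (g.support : Set (σ →₀ ℕ)) ⊆ N ∧ f - g ∈ I := by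
    intro f
    induction f using MvPolynomial.induction_on' with
    | monomial m c =>
      obtain ⟨m', hm', h⟩ := hred m
      refine ⟨MvPolynomial.monomial m' c, fun x hx => ?_, ?_⟩
      · have := MvPolynomial.support_monomial_subset hx
        rw [Finset.mem_singleton] at this
        exact this ▸ hm'
      · have := I.mul_mem_left (MvPolynomial.C c) h
        rwa [mul_sub, MvPolynomial.C_mul_monomial, MvPolynomial.C_mul_monomial, mul_one] at this
    | add p q hp hq =>
      classical
      obtain ⟨p', hp', hp⟩ := hp
      obtain ⟨q', hq', hq⟩ := hq
      refine ⟨p' + q', fun x hx => ?_, ?_⟩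
      · rcases Finset.mem_union.1 (MvPolynomial.support_add hx) with h | h
        · exact hp' h
        · exact hq' h
      · rw [add_sub_add_comm]
        exact I.add_mem hp hq
  obtain ⟨g, hg, hfg⟩ := key f
  have : g = 0 := by
    refine eq_zero_of_monomialHom_eq_zero W hN hg ?_
    have h := hI hfg
    rw [RingHom.mem_ker] at h hf
    rwa [map_sub, hf, zero_sub, neg_eq_zero] at h
  rwa [this, sub_zero] at hfg

end

/-- The principal `2`-minor of `A` with rows and columns `i` and `j`, as a function of `s(i, j)`. -/
def pairMinor {ι R : Type*} [CommRing R] (A : Matrix ι ι R) : Sym2 ι → R :=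
  Sym2.lift ⟨fun i j => A i i * A j j - A i j * A j i, fun i j => by ring⟩

theorem pairMinor_mk {ι R : Type*} [CommRing R] (A : Matrix ι ι R) (i j : ι) :
    pairMinor A s(i, j) = A i i * A j j - A i j * A j i := rfl

theorem map_pairMinor {ι R S : Type*} [CommRing R] [CommRing S] (f : R →+* S) (A : Matrix ι ι R)
    (e : Sym2 ι) : f (pairMinor A e) = pairMinor (A.map f) e := by
  induction e with | _ i j => simp [pairMinor_mk]

theorem det_submatrix_pair {ι R : Type*} [DecidableEq ι] [CommRing R] (A : Matrix ι ι R)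
    {i j : ι} (h : i ≠ j) :
    (A.submatrix (fun k : {x // x ∈ ({i, j} : Finset ι)} => (k : ι))
      (fun k : {x // x ∈ ({i, j} : Finset ι)} => (k : ι))).det = pairMinor A s(i, j) := by
  have hb : Function.Bijective
      (![⟨i, by simp⟩, ⟨j, by simp⟩] : Fin 2 → {x // x ∈ ({i, j} : Finset ι)}) := by
    constructor
    · intro a b
      fin_cases a <;> fin_cases b <;> simp [h, h.symm]
    · rintro ⟨x, hx⟩
      simp only [Finset.mem_insert, Finset.mem_singleton] at hx
      rcases hx with rfl | rfl
      · exact ⟨0, rfl⟩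
      · exact ⟨1, rfl⟩
  rw [← Matrix.det_submatrix_equiv_self (Equiv.ofBijective _ hb), Matrix.det_fin_two]
  rfl

/-- Jacobi's identity for complementary principal minors of inverse matrices. -/
theorem det_toSquareBlockProp_not {ι R : Type*} [Fintype ι] [DecidableEq ι] [CommRing R]
    {A B : Matrix ι ι R} (h : A * B = 1) (p : ι → Prop) [DecidablePred p] :
    (A.toSquareBlockProp fun i => ¬p i).det = A.det * (B.toSquareBlockProp p).det := by
  let C : Matrix ι ι R := Matrix.of fun i j => if p j then B i j else (1 : Matrix ι ι R) i j
  let D : Matrix ι ι R := Matrix.of fun i j => if p j then (1 : Matrix ι ι R) i j else A i j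
  have hD : A * C = D := by
    ext i j
    by_cases hj : p j
    · simp [C, D, hj, ← h, Matrix.mul_apply]
    · simp [C, D, hj, Matrix.mul_apply, Matrix.one_apply]
  have hCdet : C.det = (B.toSquareBlockProp p).det := by
    have h1 : C.toSquareBlockProp p = B.toSquareBlockProp p := by
      ext i j; simp [C, Matrix.toSquareBlockProp, j.2]
    have h2 : (C.toSquareBlockProp fun i => ¬p i) = 1 := by
      ext i j; simp [C, Matrix.toSquareBlockProp, j.2, Matrix.one_apply, Subtype.ext_iff]
    rw [C.twoBlockTriangular_det' p, h1, h2, Matrix.det_one, mul_one]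
    intro i hi j hj
    have : i ≠ j := fun e => hj (e ▸ hi)
    simp [C, hj, this]
  have hDdet : D.det = (A.toSquareBlockProp fun i => ¬p i).det := by
    have h1 : D.toSquareBlockProp p = 1 := by
      ext i j; simp [D, Matrix.toSquareBlockProp, j.2, Matrix.one_apply, Subtype.ext_iff]
    have h2 : (D.toSquareBlockProp fun i => ¬p i) = A.toSquareBlockProp fun i => ¬p i := by
      ext i j; simp [D, Matrix.toSquareBlockProp, j.2]
    rw [D.twoBlockTriangular_det p, h1, h2, Matrix.det_one, one_mul]
    intro i hi j hj
    have : i ≠ j := fun e => hi (e ▸ hj)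
    simp [D, hj, this]
  rw [← hDdet, ← hCdet, ← hD, Matrix.det_mul]

theorem idealHeight_eq_height {R : Type*} [CommRing R] (I : Ideal R) [hI : I.IsPrime] :
    idealHeight I = I.height := by
  rw [show I.height = Order.height (⟨I, hI⟩ : PrimeSpectrum R) from
    PrimeSpectrum.height_eq_orderHeight ⟨I, hI⟩]
  exact le_antisymm (iInf₂_le (⟨I, hI⟩ : PrimeSpectrum R) le_rfl)
    (le_iInf₂ fun p hp => Order.height_mono hp)

theorem pairMinor_mvPolynomialX {ι R : Type*} [CommRing R] (i j : ι) :
    pairMinor (Matrix.mvPolynomialX ι ι R) s(i, j) =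
      MvPolynomial.monomial (Finsupp.single (i, i) 1 + Finsupp.single (j, j) 1) 1 -
        MvPolynomial.monomial (Finsupp.single (i, j) 1 + Finsupp.single (j, i) 1) 1 := by
  rw [pairMinor_mk]
  simp [Matrix.mvPolynomialX_apply, MvPolynomial.X, MvPolynomial.monomial_mul]

section PairIdeal

variable {ι : Type*} [DecidableEq ι]

/-- The exponents of the monomials divisible by no product `x_{ij} x_{ji}` with `s(i, j) ∈ E`. -/
def pairReduced (E : Finset (Sym2 ι)) : Set (ι × ι →₀ ℕ) :=
  {m | ∀ i j, s(i, j) ∈ E → m (i, j) = 0 ∨ m (j, i) = 0}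

variable (R : Type*) [CommRing R]

/-- The ideal generated by the principal `2`-minors indexed by `E` of the generic matrix. -/
noncomputable def pairIdeal (E : Finset (Sym2 ι)) : Ideal (MvPolynomial (ι × ι) R) :=
  Ideal.span (pairMinor (Matrix.mvPolynomialX ι ι R) '' (E : Set (Sym2 ι)))

variable {R}

variable {E : Finset (Sym2 ι)}

theorem exists_pairReduced_sub_mem (hE : ∀ e ∈ E, ¬e.IsDiag) (m : ι × ι →₀ ℕ) :
    ∃ m' ∈ pairReduced E,
      MvPolynomial.monomial m (1 : R) - MvPolynomial.monomial m' 1 ∈ pairIdeal R E := by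
  induction hd : m.sum (fun p a => if p.1 = p.2 then 0 else a) using Nat.strong_induction_on
    generalizing m with
  | _ d ih
  by_cases hm : m ∈ pairReduced E
  · exact ⟨m, hm, by simp⟩
  simp only [pairReduced, Set.mem_ofPred_eq, not_forall, not_or] at hm
  obtain ⟨i, j, hij, h1, h2⟩ := hm
  have hne : i ≠ j := fun h => hE _ hij h
  obtain ⟨c, hc⟩ : ∃ c, m = c + (Finsupp.single (i, j) 1 + Finsupp.single (j, i) 1) := by
    refine ⟨m - (Finsupp.single (i, j) 1 + Finsupp.single (j, i) 1),
      (tsub_add_cancel_of_le fun p => ?_).symm⟩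
    simp only [Finsupp.add_apply, Finsupp.single_apply]
    grind
  have hsum (a b : ι × ι →₀ ℕ) : (a + b).sum (fun p x => if p.1 = p.2 then 0 else x) =
      a.sum (fun p x => if p.1 = p.2 then 0 else x) +
        b.sum (fun p x => if p.1 = p.2 then 0 else x) :=
    Finsupp.sum_add_index' (by simp) (by intros; split_ifs <;> simp)
  obtain ⟨m', hm', h⟩ := ih _ (by
    rw [← hd, hc, hsum, hsum, hsum, hsum, Finsupp.sum_single_index (by simp),
      Finsupp.sum_single_index (by simp), Finsupp.sum_single_index (by simp),
      Finsupp.sum_single_index (by simp)]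
    simp [hne, hne.symm]) (c + (Finsupp.single (i, i) 1 + Finsupp.single (j, j) 1)) rfl
  refine ⟨m', hm', ?_⟩
  have hmem := (pairIdeal R E).mul_mem_left (MvPolynomial.monomial c 1)
    (Ideal.subset_span ⟨s(i, j), hij, rfl⟩)
  rw [pairMinor_mvPolynomialX, mul_sub, MvPolynomial.monomial_mul, MvPolynomial.monomial_mul, ← hc,
    mul_one] at hmem
  have := (pairIdeal R E).sub_mem h hmem
  rwa [sub_sub_sub_cancel_left] at this

variable [Fintype ι]

/-- The weight of the toric parametrization of the variety on which the principal `2`-minors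
indexed by `E` vanish. -/
def pairWeight (E : Finset (Sym2 ι)) : (ι × ι →₀ ℕ) →+ (ι × ι → ℤ) where
  toFun m p := if s(p.1, p.2) ∈ E then (m p : ℤ) - m p.swap else
    m p + if p.1 = p.2 then ∑ k, if s(p.1, k) ∈ E then (m (p.1, k) : ℤ) else 0 else 0
  map_zero' := by ext; simp
  map_add' m m' := by
    ext p
    simp only [Finsupp.add_apply, Nat.cast_add, Pi.add_apply]
    split_ifs
    · ring
    · rw [add_add_add_comm, ← Finset.sum_add_distrib]
      congr 1
      exact Finset.sum_congr rfl fun k _ => by split_ifs <;> simp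
    · ring

theorem pairWeight_apply (E : Finset (Sym2 ι)) (m : ι × ι →₀ ℕ) (i j : ι) :
    pairWeight E m (i, j) = if s(i, j) ∈ E then (m (i, j) : ℤ) - m (j, i) else
      m (i, j) + if i = j then ∑ k, if s(i, k) ∈ E then (m (i, k) : ℤ) else 0 else 0 := rfl

theorem pairWeight_injOn :
    Set.InjOn (pairWeight E) (pairReduced E) := by
  intro m hm m' hm' h
  have hw (i j : ι) := congrFun h (i, j)
  simp only [pairWeight_apply] at hw
  have h1 (i j : ι) (hij : s(i, j) ∈ E) : m (i, j) = m' (i, j) := by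
    have h2 := hw i j
    rw [if_pos hij, if_pos hij] at h2
    have h3 := hm i j hij
    have h4 := hm' i j hij
    omega
  ext ⟨i, j⟩
  by_cases hij : s(i, j) ∈ E
  · exact h1 i j hij
  · have h2 := hw i j
    rw [if_neg hij, if_neg hij] at h2
    have h3 : (∑ k, if s(i, k) ∈ E then (m (i, k) : ℤ) else 0) =
        ∑ k, if s(i, k) ∈ E then (m' (i, k) : ℤ) else 0 :=
      Finset.sum_congr rfl fun k _ => by
        split_ifs with hk
        · rw [h1 i k hk]
        · rfl
    rw [h3] at h2
    exact_mod_cast add_right_cancel h2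

theorem pairWeight_single_diag (hE : ∀ e ∈ E, ¬e.IsDiag) (i : ι) :
    pairWeight E (Finsupp.single (i, i) 1) = Pi.single (i, i) 1 := by
  ext ⟨a, b⟩
  rw [pairWeight_apply]
  by_cases hab : s(a, b) ∈ E
  · have : a ≠ b := fun h => hE _ hab h
    rw [if_pos hab]
    simp only [Finsupp.single_apply, Pi.single_apply, Prod.mk.injEq]
    grind
  · have : (∑ k, if s(a, k) ∈ E then
        ((Finsupp.single (i, i) 1 : ι × ι →₀ ℕ) (a, k) : ℤ) else 0) = 0 := by
      refine Finset.sum_eq_zero fun k _ => ?_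
      split_ifs with hk
      · have : a ≠ k := fun h => hE _ hk h
        simp only [Finsupp.single_apply, Prod.mk.injEq]
        grind
      · rfl
    rw [if_neg hab, this, ite_self, add_zero]
    simp only [Finsupp.single_apply, Pi.single_apply]
    grind

theorem pairWeight_single_of_mem (hE : ∀ e ∈ E, ¬e.IsDiag) {i j : ι} (hij : s(i, j) ∈ E) :
    pairWeight E (Finsupp.single (i, j) 1) =
      Pi.single (i, j) 1 - Pi.single (j, i) 1 + Pi.single (i, i) 1 := by
  have hne : i ≠ j := fun h => hE _ hij h
  ext ⟨a, b⟩
  rw [pairWeight_apply]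
  simp only [Pi.add_apply, Pi.sub_apply, Pi.single_apply, Finsupp.single_apply, Prod.mk.injEq]
  by_cases hab : s(a, b) ∈ E
  · have : a ≠ b := fun h => hE _ hab h
    rw [if_pos hab]
    grind
  · have h1 : ¬(a = i ∧ b = j) := by rintro ⟨rfl, rfl⟩; exact hab hij
    have h2 : ¬(a = j ∧ b = i) := by rintro ⟨rfl, rfl⟩; exact hab (Sym2.eq_swap ▸ hij)
    have h3 : (∑ k, if s(a, k) ∈ E then (((if i = a ∧ j = k then 1 else 0 : ℕ)) : ℤ) else 0) =
        if a = i then 1 else 0 := by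
      rw [Finset.sum_eq_single j]
      · grind
      · intro k _ hk
        simp [hk.symm]
      · simp
    rw [if_neg hab, h3]
    grind

theorem pairWeight_swap (hE : ∀ e ∈ E, ¬e.IsDiag) {i j : ι} (hij : s(i, j) ∈ E) :
    pairWeight E (Finsupp.single (i, i) 1 + Finsupp.single (j, j) 1) =
      pairWeight E (Finsupp.single (i, j) 1 + Finsupp.single (j, i) 1) := by
  rw [map_add, map_add, pairWeight_single_diag hE, pairWeight_single_diag hE,
    pairWeight_single_of_mem hE hij, pairWeight_single_of_mem hE (Sym2.eq_swap ▸ hij)]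
  abel

theorem pairIdeal_le_ker (hE : ∀ e ∈ E, ¬e.IsDiag) :
    pairIdeal R E ≤ RingHom.ker (monomialHom (R := R) (pairWeight E)) := by
  rw [pairIdeal, Ideal.span_le]
  rintro _ ⟨e, he, rfl⟩
  induction e with | _ i j
  rw [SetLike.mem_coe, RingHom.mem_ker, pairMinor_mvPolynomialX, map_sub, monomialHom_monomial,
    monomialHom_monomial, pairWeight_swap hE he, sub_self]

theorem ker_monomialHom_pairWeight (hE : ∀ e ∈ E, ¬e.IsDiag) :
    RingHom.ker (monomialHom (R := R) (pairWeight E)) = pairIdeal R E :=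
  ker_monomialHom_eq _ (pairWeight_injOn) (pairIdeal_le_ker hE) (exists_pairReduced_sub_mem hE)

theorem pairIdeal_isPrime [IsDomain R] (hE : ∀ e ∈ E, ¬e.IsDiag) : (pairIdeal R E).IsPrime := by
  rw [← ker_monomialHom_pairWeight hE]
  have : IsDomain (AddMonoidAlgebra R (ι × ι → ℤ)) := NoZeroDivisors.to_isDomain _
  exact RingHom.ker_isPrime _

theorem pairMinor_notMem_pairIdeal [Nontrivial R] (hE : ∀ e ∈ E, ¬e.IsDiag) {e : Sym2 ι}
    (he : e ∉ E) (hd : ¬e.IsDiag) :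
    pairMinor (Matrix.mvPolynomialX ι ι R) e ∉
      pairIdeal R E := by
  induction e with | _ i j
  have hne : i ≠ j := fun h => hd h
  rw [← ker_monomialHom_pairWeight hE, RingHom.mem_ker, pairMinor_mvPolynomialX, map_sub, sub_eq_zero,
    monomialHom_monomial, monomialHom_monomial]
  intro h
  have h' := congrArg AddMonoidAlgebra.coeff h
  simp only [AddMonoidAlgebra.coeff_single] at h'
  have h'' := congrFun (Finsupp.single_left_injective one_ne_zero h') (i, j)
  simp [pairWeight_apply, he, hne, hne.symm] at h''

theorem height_pairIdeal [IsDomain R] [IsNoetherianRing R] (hE : ∀ e ∈ E, ¬e.IsDiag) :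
    (pairIdeal R E).height = E.card := by
  apply le_antisymm
  · have := pairIdeal_isPrime (R := R) hE
    refine (Ideal.height_le_card_of_mem_minimalPrimes_span (E.finite_toSet.image
      (pairMinor (Matrix.mvPolynomialX ι ι R))) ?_).trans ?_
    · exact Ideal.minimalPrimes_eq_subsingleton_self (I := pairIdeal R E) ▸ Set.mem_singleton _
    · exact_mod_cast (Set.ncard_image_le E.finite_toSet).trans_eq (Set.ncard_coe_finset E)
  · induction E using Finset.induction_on with
    | empty => simp
    | insert e E he ih =>
      have hE' : ∀ e ∈ E, ¬e.IsDiag := fun x hx => hE x (Finset.mem_insert_of_mem hx)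
      have := pairIdeal_isPrime (R := R) hE
      have := pairIdeal_isPrime (R := R) hE'
      have hlt : pairIdeal R E < pairIdeal R (insert e E) := by
        refine lt_of_le_of_ne (Ideal.span_mono (Set.image_mono (by simp))) fun h => ?_
        refine pairMinor_notMem_pairIdeal (R := R) hE' he (hE e (Finset.mem_insert_self _ _)) ?_
        rw [h]
        exact Ideal.subset_span ⟨e, by simp, rfl⟩
      rw [Finset.card_insert_of_notMem he, Nat.cast_add, Nat.cast_one]
      exact (add_le_add_left (ih hE') 1).trans (Ideal.height_add_one_le_of_lt_of_isPrime hlt)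

end PairIdeal

theorem det_submatrix_compl {ι R : Type*} [Fintype ι] [DecidableEq ι] [CommRing R]
    {A B : Matrix ι ι R} (h : A * B = 1) (s : Finset ι) :
    (A.submatrix (fun i : {x // x ∈ sᶜ} => (i : ι)) (fun i : {x // x ∈ sᶜ} => (i : ι))).det =
      A.det * (B.submatrix (fun i : {x // x ∈ s} => (i : ι))
        (fun i : {x // x ∈ s} => (i : ι))).det := by
  rw [← Matrix.det_submatrix_equiv_self
    (Equiv.subtypeEquivRight fun x => (Finset.mem_compl (s := s) (a := x)).symm)]
  convert! det_toSquareBlockProp_not h (· ∈ s)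

/-- Jacobi's identity identifies the ideal of principal minors of size `card ι - 2` of an
invertible matrix with the ideal of principal `2`-minors of its inverse. -/
theorem span_principalMinors_eq_span_pairMinor {ι R : Type*} [Fintype ι] [DecidableEq ι]
    [CommRing R] (hι : 2 ≤ Fintype.card ι) {A B : Matrix ι ι R} (h : A * B = 1) :
    Ideal.span {p | ∃ s : Finset ι, s.card = Fintype.card ι - 2 ∧
      p = (A.submatrix (fun i : {x // x ∈ s} => (i : ι))
        (fun j : {x // x ∈ s} => (j : ι))).det} =
      Ideal.span (pairMinor B '' {e | ¬e.IsDiag}) := by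
  have hu : IsUnit A.det := .of_mul_eq_one B.det (by rw [← Matrix.det_mul, h, Matrix.det_one])
  apply le_antisymm
  · rw [Ideal.span_le]
    rintro _ ⟨s, hs, rfl⟩
    obtain ⟨i, j, hij, hsc⟩ := Finset.card_eq_two.1 (show sᶜ.card = 2 by
      rw [Finset.card_compl, hs]; omega)
    obtain rfl : s = ({i, j} : Finset ι)ᶜ := by rw [← hsc, compl_compl]
    rw [det_submatrix_compl h, det_submatrix_pair B hij]
    exact Ideal.mul_mem_left _ _ (Ideal.subset_span ⟨s(i, j), hij, rfl⟩)
  · rw [Ideal.span_le]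
    rintro _ ⟨e, he, rfl⟩
    induction e with | _ i j
    rw [SetLike.mem_coe, ← Ideal.unit_mul_mem_iff_mem _ hu, ← det_submatrix_pair B he,
      ← det_submatrix_compl h]
    refine Ideal.subset_span ⟨_, ?_, rfl⟩
    rw [Finset.card_compl, Finset.card_pair he]

section Generic

variable (K : Type*) [Field K] (n : ℕ)

/-- The generic matrix over the coordinate ring of the general linear group. -/
noncomputable abbrev unitGenMat : Matrix (Fin n) (Fin n) (Localization.Away (genMat K n).det) :=
  (genMat K n).map (algebraMap _ _)

theorem isUnit_det_unitGenMat : IsUnit (unitGenMat K n).det := by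
  have h := IsLocalization.Away.algebraMap_isUnit (S := Localization.Away (genMat K n).det)
    (genMat K n).det
  rwa [RingHom.map_det] at h

/-- The homomorphism from the polynomial ring sending the generic matrix to its inverse. -/
noncomputable def polyInv :
    MvPolynomial (Fin n × Fin n) K →ₐ[K] Localization.Away (genMat K n).det :=
  MvPolynomial.aeval fun p => (unitGenMat K n)⁻¹ p.1 p.2

theorem genMat_map_polyInv :
    (genMat K n).map (polyInv K n) = (unitGenMat K n)⁻¹ := by
  ext i j
  simp [genMat, polyInv]

theorem isUnit_polyInv_det : IsUnit (polyInv K n (genMat K n).det) := by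
  rw [AlgHom.map_det, AlgHom.mapMatrix_apply, genMat_map_polyInv]
  exact Matrix.isUnit_nonsing_inv_det _ (isUnit_det_unitGenMat K n)

/-- The endomorphism of the coordinate ring of the general linear group induced by matrix
inversion. -/
noncomputable def locInv :
    Localization.Away (genMat K n).det →+* Localization.Away (genMat K n).det :=
  IsLocalization.Away.lift (g := (polyInv K n : _ →+* _)) (genMat K n).det (isUnit_polyInv_det K n)

theorem locInv_algebraMap (f : MvPolynomial (Fin n × Fin n) K) :
    locInv K n (algebraMap _ _ f) = polyInv K n f :=
  IsLocalization.Away.lift_eq _ _ _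

theorem unitGenMat_map_locInv : (unitGenMat K n).map (locInv K n) = (unitGenMat K n)⁻¹ := by
  rw [← genMat_map_polyInv]
  ext i j
  simp [locInv_algebraMap]

theorem inv_unitGenMat_map_locInv :
    (unitGenMat K n)⁻¹.map (locInv K n) = unitGenMat K n := by
  have h : (unitGenMat K n)⁻¹ * (unitGenMat K n)⁻¹.map (locInv K n) = 1 := by
    have h := Matrix.mul_nonsing_inv _ (isUnit_det_unitGenMat K n)
    have h' := congrArg (locInv K n).mapMatrix h
    rwa [map_mul, map_one, RingHom.mapMatrix_apply, RingHom.mapMatrix_apply,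
      unitGenMat_map_locInv] at h'
  rw [← Matrix.inv_eq_right_inv h,
    Matrix.nonsing_inv_nonsing_inv _ (isUnit_det_unitGenMat K n)]

theorem locInv_comp_locInv : (locInv K n).comp (locInv K n) = RingHom.id _ := by
  refine IsLocalization.ringHom_ext (Submonoid.powers (genMat K n).det) ?_
  refine MvPolynomial.ringHom_ext (fun c => ?_) fun p => ?_
  · have h : polyInv K n (MvPolynomial.C c) =
        algebraMap (MvPolynomial (Fin n × Fin n) K) _ (MvPolynomial.C c) := by
      rw [← MvPolynomial.algebraMap_eq, AlgHom.commutes, ← IsScalarTower.algebraMap_apply]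
    simp only [RingHom.comp_apply, RingHom.id_apply, locInv_algebraMap, h]
  · have h := congrFun₂ (inv_unitGenMat_map_locInv K n) p.1 p.2
    simp only [RingHom.comp_apply, RingHom.id_apply, locInv_algebraMap, polyInv,
      MvPolynomial.aeval_X]
    exact h

/-- The involution of the coordinate ring of the general linear group induced by matrix
inversion. -/
noncomputable def locInvEquiv :
    Localization.Away (genMat K n).det ≃+* Localization.Away (genMat K n).det :=
  RingEquiv.ofRingHom (locInv K n) (locInv K n) (locInv_comp_locInv K n) (locInv_comp_locInv K n)

/-- The set of pairs of distinct indices. -/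
def offDiagPairs (n : ℕ) : Finset (Sym2 (Fin n)) := Finset.univ.filter fun e => ¬e.IsDiag

theorem not_isDiag_of_mem_offDiagPairs {n : ℕ} : ∀ e ∈ offDiagPairs n, ¬e.IsDiag :=
  fun _ he => (Finset.mem_filter.1 he).2

theorem card_offDiagPairs : (offDiagPairs n).card = n * (n - 1) / 2 := by
  rw [← Nat.choose_two_right, offDiagPairs, ← Fintype.card_subtype, Sym2.card_subtype_not_diag,
    Fintype.card_fin]

theorem map_locInvEquiv_pairIdeal {n : ℕ} (hn : 2 ≤ n) :
    ((pairIdeal K (offDiagPairs n)).map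
      (algebraMap _ (Localization.Away (genMat K n).det))).map (locInvEquiv K n) =
      (prinMinorIdeal K n (n - 2)).map (algebraMap _ _) := by
  have h1 : ((pairIdeal K (offDiagPairs n)).map
      (algebraMap _ (Localization.Away (genMat K n).det))).map (locInvEquiv K n) =
      Ideal.span (pairMinor (unitGenMat K n)⁻¹ '' {e | ¬e.IsDiag}) := by
    rw [pairIdeal, Ideal.map_span, Ideal.map_span, Set.image_image, Set.image_image]
    congr 1
    have : ((offDiagPairs n : Finset _) : Set (Sym2 (Fin n))) = {e | ¬e.IsDiag} := by
      ext; simp [offDiagPairs]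
    rw [this]
    refine Set.image_congr fun e _ => ?_
    rw [map_pairMinor, ← unitGenMat_map_locInv, ← map_pairMinor (locInv K n)]
    rfl
  have h2 : (prinMinorIdeal K n (n - 2)).map
      (algebraMap _ (Localization.Away (genMat K n).det)) =
      Ideal.span {p | ∃ s : Finset (Fin n), s.card = Fintype.card (Fin n) - 2 ∧
      p = ((unitGenMat K n).submatrix (fun i : {x // x ∈ s} => (i : Fin n))
        (fun j : {x // x ∈ s} => (j : Fin n))).det} := by
    rw [prinMinorIdeal, Ideal.map_span]
    congr 1
    ext p
    constructor
    · rintro ⟨_, ⟨s, hs, rfl⟩, rfl⟩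
      exact ⟨s, by simpa using hs, by rw [RingHom.map_det]; rfl⟩
    · rintro ⟨s, hs, rfl⟩
      exact ⟨_, ⟨s, by simpa using hs, rfl⟩, by rw [RingHom.map_det]; rfl⟩
  rw [h1, h2, span_principalMinors_eq_span_pairMinor (by simpa using hn)
    (Matrix.mul_nonsing_inv _ (isUnit_det_unitGenMat K n))]

theorem det_genMat_notMem_pairIdeal {n : ℕ} (hn : 3 ≤ n) :
    (genMat K n).det ∉ pairIdeal K (offDiagPairs n) := by
  obtain ⟨n, rfl⟩ : ∃ k, n = k + 3 := ⟨n - 3, by omega⟩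
  let M : Matrix (Fin (n + 3)) (Fin (n + 3)) K := (finRotate (n + 3)).permMatrix K
  let φ : MvPolynomial (Fin (n + 3) × Fin (n + 3)) K →ₐ[K] K :=
    MvPolynomial.aeval fun p => M p.1 p.2
  have hφ : (genMat K (n + 3)).map φ = M := by
    ext i j
    simp [genMat, φ]
  have hle : pairIdeal K (offDiagPairs (n + 3)) ≤ RingHom.ker (φ : _ →+* K) := by
    rw [pairIdeal, Ideal.span_le]
    rintro _ ⟨e, he, rfl⟩
    rw [SetLike.mem_coe, RingHom.mem_ker, map_pairMinor]
    change pairMinor ((genMat K (n + 3)).map φ) e = 0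
    rw [hφ]
    induction e with | _ i j
    have hne : i ≠ j := not_isDiag_of_mem_offDiagPairs _ he
    rw [pairMinor_mk]
    have hM (a b) : M a b = if b = a + 1 then 1 else 0 := by
      simp [M, PEquiv.toMatrix_apply, eq_comm]
    have h1 : i ≠ i + 1 := by simp
    have h2 : ¬(j = i + 1 ∧ i = j + 1) := by
      rintro ⟨rfl, h⟩
      rw [add_assoc, left_eq_add] at h
      have := congrArg Fin.val h
      simp only [Fin.val_add, Fin.val_one, Fin.val_zero] at this
      rw [Nat.mod_eq_of_lt (by omega)] at this
      omega
    simp only [hM, if_neg h1]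
    grind
  intro h
  have h0 := hle h
  rw [RingHom.mem_ker, RingHom.coe_coe, AlgHom.map_det, AlgHom.mapMatrix_apply, hφ,
    Matrix.det_permutation] at h0
  rcases Int.units_eq_one_or (Equiv.Perm.sign (finRotate (n + 3))) with h | h <;>
    simp [h] at h0

end Generic

/-- For `n ≥ 3`, the extension `P_{n-2}·S_Δ` of the principal `(n-2)`-minor ideal
to the localization `S_Δ = S[1/Δ]` is a prime ideal of `S_Δ` of height `n(n-1)/2`.
(Equivalently, the locally closed set `Y_{n,n,n-2}` of invertible matrices with
vanishing principal `(n-2)`-minors is irreducible of codimension `n(n-1)/2`.) -/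
theorem prinMinorIdeal_sub_two_localized_prime (K : Type*) [Field K] [IsAlgClosed K]
    (n : ℕ) (hn : 3 ≤ n) :
    (Ideal.map (algebraMap (MvPolynomial (Fin n × Fin n) K)
        (Localization.Away (genMat K n).det)) (prinMinorIdeal K n (n - 2))).IsPrime ∧
      idealHeight (Ideal.map (algebraMap (MvPolynomial (Fin n × Fin n) K)
        (Localization.Away (genMat K n).det)) (prinMinorIdeal K n (n - 2))) =
        ((n * (n - 1) / 2 : ℕ) : ℕ∞) := by
  have hP : (pairIdeal K (offDiagPairs n)).IsPrime :=
    pairIdeal_isPrime not_isDiag_of_mem_offDiagPairs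
  have hdisj : Disjoint (Submonoid.powers (genMat K n).det : Set (MvPolynomial (Fin n × Fin n) K))
      (pairIdeal K (offDiagPairs n)) :=
    (Ideal.disjoint_powers_iff_notMem _ hP.isRadical).2 (det_genMat_notMem_pairIdeal K hn)
  have hloc : ((pairIdeal K (offDiagPairs n)).map
      (algebraMap _ (Localization.Away (genMat K n).det))).IsPrime :=
    IsLocalization.isPrime_of_isPrime_disjoint (Submonoid.powers (genMat K n).det) _ _ hP hdisj
  rw [← map_locInvEquiv_pairIdeal K (by omega)]
  have hprime := Ideal.map_isPrime_of_equiv (locInvEquiv K n) (I := (pairIdeal K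
    (offDiagPairs n)).map (algebraMap _ (Localization.Away (genMat K n).det)))
  refine ⟨hprime, ?_⟩
  rw [idealHeight_eq_height, RingEquiv.height_map,
    IsLocalization.height_map_of_disjoint (Submonoid.powers (genMat K n).det) _ hdisj,
    height_pairIdeal not_isDiag_of_mem_offDiagPairs, card_offDiagPairs]
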